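/- Every graph that is P6-free, diamond-free and K4-free is 6-colorable. -/

import Mathlib

open SimpleGraph

/-- The disjoint union `P2 ∪ P3`, on 5 vertices: edges 01, 23, 34. -/
def p2p3 : SimpleGraph (Fin 5) :=
  SimpleGraph.fromEdgeSet {s(0, 1), s(2, 3), s(3, 4)}

/-- The diamond: `K4` minus the edge 02. -/
def diamond : SimpleGraph (Fin 4) :=
  SimpleGraph.fromEdgeSet {s(0, 1), s(1, 2), s(2, 3), s(0, 3), s(1, 3)}

/-- The bull: vertices v1,...,v5 are 0,...,4; edges v1v2, v2v3, v3v4, v2v5, v3v5. -/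
def bull : SimpleGraph (Fin 5) :=
  SimpleGraph.fromEdgeSet {s(0, 1), s(1, 2), s(2, 3), s(1, 4), s(2, 4)}

/-- `K4`, the complete graph on 4 vertices. -/
def K4 : SimpleGraph (Fin 4) := ⊤

/-- `G` contains no induced subgraph isomorphic to `H`
(graph embeddings are exactly induced copies). -/
def IndFree {α β : Type*} (H : SimpleGraph α) (G : SimpleGraph β) : Prop :=
  ¬ Nonempty (H ↪g G)


section

variable {V : Type*} {G : SimpleGraph V}

/-- Every edge lies in at most one triangle. -/
def UniqueTriangles (G : SimpleGraph V) : Prop :=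
  ∀ u v c d, G.Adj u v → G.Adj u c → G.Adj v c → G.Adj u d → G.Adj v d → c = d

/-- No six vertices induce a path in the given order. -/
def NoInducedSixPath (G : SimpleGraph V) : Prop :=
  ∀ a b c d e f, G.Adj a b → G.Adj b c → G.Adj c d → G.Adj d e → G.Adj e f →
    ¬ G.Adj a c → ¬ G.Adj a d → ¬ G.Adj a e → ¬ G.Adj a f → ¬ G.Adj b d → ¬ G.Adj b e →
    ¬ G.Adj b f → ¬ G.Adj c e → ¬ G.Adj c f → ¬ G.Adj d f → False

theorem uniqueTriangles_of_indFree (hD : IndFree diamond G) (hK : IndFree K4 G) :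
    UniqueTriangles G := by
  intro u v c d huv huc hvc hud hvd
  by_contra hcd
  by_cases h : G.Adj c d
  · have hadj : ∀ i j, G.Adj (![u, v, c, d] i) (![u, v, c, d] j) ↔ K4.Adj i j := by
      intro i j
      fin_cases i <;> fin_cases j <;> simp_all [K4, G.adj_comm]
    refine hK ⟨⟨⟨![u, v, c, d], ?_⟩, fun {i j} => hadj i j⟩⟩
    · intro i j hij
      have := huv.ne; have := huc.ne; have := hvc.ne; have := hud.ne; have := hvd.ne
      fin_cases i <;> fin_cases j <;> simp_all [eq_comm]
  · have hadj : ∀ i j, G.Adj (![c, u, d, v] i) (![c, u, d, v] j) ↔ diamond.Adj i j := by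
      intro i j
      fin_cases i <;> fin_cases j <;> simp_all [diamond, G.adj_comm]
    refine hD ⟨⟨⟨![c, u, d, v], ?_⟩, fun {i j} => hadj i j⟩⟩
    · intro i j hij
      have := huv.ne; have := huc.ne; have := hvc.ne; have := hud.ne; have := hvd.ne
      fin_cases i <;> fin_cases j <;> simp_all [eq_comm]

theorem noInducedSixPath_of_indFree (hP : IndFree (pathGraph 6) G) : NoInducedSixPath G := by
  intro a b c d e f hab hbc hcd hde hef hac had hae haf hbd hbe hbf hce hcf hdf
  have hadj : ∀ i j, G.Adj (![a, b, c, d, e, f] i) (![a, b, c, d, e, f] j) ↔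
      (pathGraph 6).Adj i j := by
    intro i j
    rw [pathGraph_adj]
    fin_cases i <;> fin_cases j <;> simp_all [G.adj_comm]
  have htwin : ∀ i j : Fin 6, (∀ k : Fin 6, (i.val + 1 = k.val ∨ k.val + 1 = i.val) ↔
      (j.val + 1 = k.val ∨ k.val + 1 = j.val)) → i = j := by decide
  refine hP ⟨⟨⟨![a, b, c, d, e, f], fun i j hij => htwin i j fun k => ?_⟩, fun {i j} => hadj i j⟩⟩
  rw [← pathGraph_adj, ← pathGraph_adj, ← hadj, ← hadj]
  exact iff_of_eq (congrArg (fun x => G.Adj x (![a, b, c, d, e, f] k)) hij)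

/-- `K` is a connected component of the subgraph of `G` induced on `D`. -/
structure IsComp (G : SimpleGraph V) (D K : Set V) : Prop where
  subset : K ⊆ D
  closed : ∀ k ∈ K, ∀ u ∈ D, G.Adj k u → u ∈ K
  connected : ∀ P : Set V, (∃ k ∈ K, k ∈ P) →
    (∀ k ∈ K, ∀ u ∈ K, k ∈ P → G.Adj k u → u ∈ P) → K ⊆ P

theorem IsComp.eq_of_mem {D K L : Set V} (hK : IsComp G D K) (hL : IsComp G D L) {k : V}
    (h : k ∈ K) (h' : k ∈ L) : K = L :=
  (hK.connected L ⟨k, h, h'⟩ fun a _ u hu ha hau => hL.closed a ha u (hK.subset hu) hau).antisymm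
    (hL.connected K ⟨k, h', h⟩ fun a _ u hu ha hau => hK.closed a ha u (hL.subset hu) hau)

theorem exists_isComp {D : Set V} {r : V} (hr : r ∈ D) : ∃ K, IsComp G D K ∧ r ∈ K := by
  refine ⟨{x | Relation.ReflTransGen (fun a b => G.Adj a b ∧ a ∈ D ∧ b ∈ D) r x}, ⟨?_, ?_, ?_⟩, .refl⟩
  · intro x hx
    rcases Relation.ReflTransGen.cases_tail hx with h | ⟨_, _, h⟩
    · exact h ▸ hr
    · exact h.2.2
  · intro k hk u hu hku
    refine Relation.ReflTransGen.tail hk ⟨hku, ?_, hu⟩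
    rcases Relation.ReflTransGen.cases_tail hk with h | ⟨_, _, h⟩
    · exact h ▸ hr
    · exact h.2.2
  · rintro P ⟨k, hk, hkP⟩ hP
    have hrP : r ∈ P := by
      induction hk with
      | refl => exact hkP
      | tail hx h ih => exact ih (hP _ (hx.tail h) _ hx hkP h.1.symm)
    intro x hx
    induction hx with
    | refl => exact hrP
    | tail hx' h ih => exact hP _ hx' _ (hx'.tail h) ih h.1

/-- Along an edge pair leaving the neighbourhood of `w` inside `K`, the vertex of the
neighbourhood sees both ends. -/
def Dominating (G : SimpleGraph V) (w : V) (K : Set V) : Prop :=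
  ∀ k ∈ K, ∀ a ∈ K, ∀ b ∈ K, G.Adj w k → G.Adj k a → G.Adj a b → ¬ G.Adj w a → ¬ G.Adj w b →
    G.Adj k b

/-- The non-neighbours of `w` in `K` are independent. -/
def SplitBy (G : SimpleGraph V) (w : V) (K : Set V) : Prop :=
  ∀ a ∈ K, ∀ b ∈ K, ¬ G.Adj w a → ¬ G.Adj w b → ¬ G.Adj a b

/-- The vertex set `K` is a triangle. -/
def IsTriangle (G : SimpleGraph V) (K : Set V) : Prop :=
  ∃ x y z, G.Adj x y ∧ G.Adj y z ∧ G.Adj x z ∧ ∀ u, u ∈ K ↔ u = x ∨ u = y ∨ u = z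

/-- `G` induces a bipartite graph on `K`. -/
def BipartiteOn (G : SimpleGraph V) (K : Set V) : Prop :=
  ∃ P : Set V, ∀ a ∈ K, ∀ b ∈ K, G.Adj a b → (a ∈ P ↔ b ∉ P)

theorem dominating_of_tail (hP : NoInducedSixPath G) {p q w : V} {K : Set V} (hpq : G.Adj p q)
    (hqw : G.Adj q w) (hpw : ¬ G.Adj p w) (hp : ∀ k ∈ K, ¬ G.Adj p k)
    (hq : ∀ k ∈ K, ¬ G.Adj q k) : Dominating G w K := by
  intro k hk a ha b hb hwk hka hab hwa hwb
  by_contra hkb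
  exact hP p q w k a b hpq hqw hwk hka hab hpw (hp k hk) (hp a ha) (hp b hb) (hq k hk) (hq a ha)
    (hq b hb) hwa hwb hkb

theorem Dominating.exists_adj {D K : Set V} {w : V} (hw : Dominating G w K) (hK : IsComp G D K)
    (ht : ∃ k ∈ K, G.Adj w k) {y : V} (hy : y ∈ K) (hwy : ¬ G.Adj w y) :
    ∃ x ∈ K, G.Adj w x ∧ G.Adj x y := by
  have h := hK.connected {y | G.Adj w y ∨ ∃ x ∈ K, G.Adj w x ∧ G.Adj x y}
    (by obtain ⟨k, hk, hwk⟩ := ht; exact ⟨k, hk, Or.inl hwk⟩) (by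
      rintro a ha b hb (h | ⟨x, hx, hwx, hxa⟩) hab
      · exact Or.inr ⟨a, ha, h, hab⟩
      · by_cases hwa : G.Adj w a
        · exact Or.inr ⟨a, ha, hwa, hab⟩
        by_cases hwb : G.Adj w b
        · exact Or.inl hwb
        exact Or.inr ⟨x, hx, hwx, hw x hx a ha b hb hwx hxa hab hwa hwb⟩) hy
  exact h.resolve_left hwy

theorem Dominating.exists_triangle (hU : UniqueTriangles G) {D K : Set V} {w : V}
    (hw : Dominating G w K) (hK : IsComp G D K) (ht : ∃ k ∈ K, G.Adj w k) {y z : V} (hy : y ∈ K)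
    (hz : z ∈ K) (hwy : ¬ G.Adj w y) (hwz : ¬ G.Adj w z) (hyz : G.Adj y z) :
    ∃ x ∈ K, G.Adj w x ∧ G.Adj x y ∧ G.Adj x z ∧ (∀ u ∈ K, G.Adj y u → u = x ∨ u = z) ∧
      ∀ u ∈ K, G.Adj z u → u = x ∨ u = y := by
  obtain ⟨x, hx, hwx, hxy⟩ := hw.exists_adj hK ht hy hwy
  have hxz := hw x hx y hy z hz hwx hxy hyz hwy hwz
  refine ⟨x, hx, hwx, hxy, hxz, fun u hu hyu => ?_, fun u hu hzu => ?_⟩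
  · by_cases hwu : G.Adj w u
    · have := hw u hu y hy z hz hwu hyu.symm hyz hwy hwz
      exact Or.inl (hU y z u x hyz hyu this.symm hxy.symm hxz.symm)
    · have := hw x hx y hy u hu hwx hxy hyu hwy hwu
      exact Or.inr (hU x y u z hxy this hyu hxz hyz)
  · by_cases hwu : G.Adj w u
    · have := hw u hu z hz y hy hwu hzu.symm hyz.symm hwz hwy
      exact Or.inl (hU y z u x hyz this.symm hzu hxy.symm hxz.symm)
    · have := hw x hx z hz u hu hwx hxz hzu hwz hwu
      exact Or.inr (hU x z u y hxz this hzu hxy hyz.symm)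

/-- The neighbourhood of `w` has a proper two-colouring constant on a given independent set. -/
theorem exists_two_coloring [Finite V] (hU : UniqueTriangles G) (w : V) (S : Set V)
    (hS : ∀ s ∈ S, ∀ t ∈ S, ¬ G.Adj s t) :
    ∃ f : V → Bool, (∀ a b, G.Adj w a → G.Adj w b → G.Adj a b → f a ≠ f b) ∧
      ∀ a ∈ S, f a = false := by
  classical
  obtain ⟨n, ⟨e⟩⟩ := Finite.exists_equiv_fin V
  refine ⟨fun a => decide (a ∉ S ∧ ∃ m, G.Adj w m ∧ G.Adj a m ∧ (m ∈ S ∨ e m < e a)), ?_, ?_⟩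
  · have key : ∀ a b, G.Adj w a → G.Adj w b → G.Adj a b →
        ((∃ m, G.Adj w m ∧ G.Adj a m ∧ (m ∈ S ∨ e m < e a)) ↔ (b ∈ S ∨ e b < e a)) := by
      intro a b ha hb hab
      refine ⟨?_, fun h => ⟨b, hb, hab, h⟩⟩
      rintro ⟨m, hm, ham, h⟩
      rwa [hU w a m b ha hm ham hb hab] at h
    intro a b ha hb hab
    have h1 := key a b ha hb hab
    have h2 := key b a hb ha hab.symm
    have h3 : e a ≠ e b := fun h => hab.ne (e.injective h)
    have h4 : a ∈ S → b ∉ S := fun h h' => hS a h b h' hab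
    simp only [h1, h2, ne_eq, decide_eq_decide]
    rcases lt_or_gt_of_ne h3 with h | h
    · have := h.not_gt
      tauto
    · have := h.not_gt
      tauto
  · intro a ha
    simp [ha]

theorem SplitBy.exists_coloring [Finite V] (hU : UniqueTriangles G) {w : V} {K : Set V}
    (h : SplitBy G w K) : ∃ c : V → Fin 3, (∀ a ∈ K, ∀ b ∈ K, G.Adj a b → c a ≠ c b) ∧
      ∀ a, c a = 0 → ¬ G.Adj w a := by
  classical
  obtain ⟨f, hf, -⟩ := exists_two_coloring hU w ∅ (by simp)
  refine ⟨fun a => if G.Adj w a then (if f a then 1 else 2) else 0, ?_, ?_⟩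
  · intro a ha b hb hab
    have h1 := h a ha b hb
    have h2 := hf a b
    by_cases hwa : G.Adj w a <;> by_cases hwb : G.Adj w b <;> cases hfa : f a <;>
      cases hfb : f b <;> simp_all
  · intro a
    by_cases hwa : G.Adj w a <;> cases hfa : f a <;> simp_all

/-- The vertices adjacent to neither end of the edge `pq`. -/
def farSet (G : SimpleGraph V) (p q : V) : Set V := {u | ¬ G.Adj p u ∧ ¬ G.Adj q u}

/-- `w` is a further neighbour of exactly one end of the edge `pq`. -/
def IsPrivate (G : SimpleGraph V) (p q w : V) : Prop :=
  (G.Adj p w ∧ w ≠ q ∧ ¬ G.Adj q w) ∨ (G.Adj q w ∧ w ≠ p ∧ ¬ G.Adj p w)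

/-- Every vertex has a neighbour outside any three given vertices. -/
def FourNeighbors (G : SimpleGraph V) : Prop :=
  ∀ v a b c, ∃ u, G.Adj v u ∧ u ≠ a ∧ u ≠ b ∧ u ≠ c

theorem IsPrivate.dominating (hP : NoInducedSixPath G) {p q w : V} (hpq : G.Adj p q)
    (hw : IsPrivate G p q w) {K : Set V} (hK : IsComp G (farSet G p q) K) :
    Dominating G w K := by
  rcases hw with ⟨h1, -, h2⟩ | ⟨h1, -, h2⟩
  · exact dominating_of_tail hP hpq.symm h1 h2 (fun k hk => (hK.subset hk).2)
      fun k hk => (hK.subset hk).1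
  · exact dominating_of_tail hP hpq h1 h2 (fun k hk => (hK.subset hk).1)
      fun k hk => (hK.subset hk).2

/-- Every private vertex touching `K` splits it. -/
def SplitByPrivate (G : SimpleGraph V) (p q : V) (K : Set V) : Prop :=
  ∀ w, IsPrivate G p q w → (∃ k ∈ K, G.Adj w k) → SplitBy G w K

theorem isTriangle_or_splitByPrivate (hU : UniqueTriangles G) (hP : NoInducedSixPath G)
    (hN : FourNeighbors G) {p q : V} (hpq : G.Adj p q) {K : Set V}
    (hK : IsComp G (farSet G p q) K) : IsTriangle G K ∨ SplitByPrivate G p q K := by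
  by_contra! hcon
  obtain ⟨hT, hS⟩ := hcon
  unfold SplitByPrivate SplitBy at hS
  push Not at hS
  obtain ⟨w, hw, ht, y, hy, z, hz, hwy, hwz, hyz⟩ := hS
  obtain ⟨x, hx, hwx, hxy, hxz, hny, hnz⟩ :=
    (hw.dominating hP hpq hK).exists_triangle hU hK ht hy hz hwy hwz hyz
  obtain ⟨c, hc⟩ : ∃ c, ∀ u, G.Adj p u → G.Adj q u → u = c := by
    by_cases h : ∃ c, G.Adj p c ∧ G.Adj q c
    · obtain ⟨c, h1, h2⟩ := h
      exact ⟨c, fun u h3 h4 => hU p q u c hpq h3 h4 h1 h2⟩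
    · push Not at h
      exact ⟨p, fun u h3 h4 => absurd h4 (h u h3)⟩
  obtain ⟨u, hyu, hux, huz, huc⟩ := hN y x z c
  have hyD := hK.subset hy
  have huK : u ∉ K := fun h => (hny u h hyu).elim hux huz
  have huD : ¬ (¬ G.Adj p u ∧ ¬ G.Adj q u) := fun h => huK (hK.closed y hy u h hyu)
  have hup : u ≠ p := fun h => hyD.1 (h ▸ hyu.symm)
  have huq : u ≠ q := fun h => hyD.2 (h ▸ hyu.symm)
  have hu : IsPrivate G p q u := by
    have := hc u
    unfold IsPrivate
    tauto
  have hnx : ¬ G.Adj u x := fun h => huz (hU x y u z hxy h.symm hyu hxz hyz)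
  have hnz' : ¬ G.Adj u z := fun h => hux (hU y z u x hyz hyu h.symm hxy.symm hxz.symm)
  obtain ⟨x', hx', -, -, -, hnx', -⟩ :=
    (hu.dominating hP hpq hK).exists_triangle hU hK ⟨y, hy, hyu.symm⟩ hx hz hnx hnz' hxz
  have hyx' : y = x' := (hnx' y hy hxy).resolve_right hyz.ne
  subst hyx'
  refine hT ⟨x, y, z, hxy, hyz, hxz, fun u => ⟨fun h => ?_, ?_⟩⟩
  · refine hK.connected {u | u = x ∨ u = y ∨ u = z} ⟨x, hx, Or.inl rfl⟩ ?_ h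
    rintro a - b hb (rfl | rfl | rfl) hab
    · exact Or.inr (hnx' b hb hab)
    · exact (hny b hb hab).imp_right Or.inr
    · have := hnz b hb hab
      simp only [Set.mem_ofPred_eq]
      tauto
  · rintro (rfl | rfl | rfl) <;> assumption

/-- Glueing: two colours on the neighbours of `p`, two on the remaining neighbours of `q`, and
component by component on the rest. -/
theorem colorable_of_components [Finite V] (hU : UniqueTriangles G) {p q : V} (S : Set V)
    (hS : ∀ s ∈ S, ∀ t ∈ S, ¬ G.Adj s t)
    (hc : ∀ K, IsComp G (farSet G p q) K → ∃ c : V → Fin 6,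
      (∀ a ∈ K, ∀ b ∈ K, G.Adj a b → c a ≠ c b) ∧ ∀ a ∈ K, ∀ u, u ∉ farSet G p q → G.Adj a u →
        c a = 4 ∨ c a = 5 ∨ (c a = 1 ∧ (G.Adj p u → u ∈ S))) : G.Colorable 6 := by
  classical
  obtain ⟨f, hf, hfS⟩ := exists_two_coloring hU p S hS
  obtain ⟨g, hg, -⟩ := exists_two_coloring hU q ∅ (by simp)
  have hcomp : ∀ u, ∃ K, u ∈ farSet G p q → IsComp G (farSet G p q) K ∧ u ∈ K := fun u => by
    by_cases hu : u ∈ farSet G p q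
    · obtain ⟨K, hK⟩ := exists_isComp (G := G) hu
      exact ⟨K, fun _ => hK⟩
    · exact ⟨∅, fun h => absurd h hu⟩
  choose K hK using hcomp
  choose! c hc hcS using hc
  let d : V → Fin 6 := fun u => if G.Adj p u then (if f u then 1 else 0) else
    if G.Adj q u then (if g u then 3 else 2) else c (K u) u
  have hmixed : ∀ a b, a ∈ farSet G p q → b ∉ farSet G p q → G.Adj a b → d a ≠ d b := by
    intro a b ha hb hab
    have h1 := hcS _ (hK a ha).1 a (hK a ha).2 b hb hab
    have h2 : d a = c (K a) a := by simp [d, ha.1, ha.2]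
    have h3 := hfS b
    rw [h2]
    simp only [farSet, Set.mem_ofPred_eq] at hb
    by_cases hpb : G.Adj p b
    · rcases h1 with h | h | ⟨h, h'⟩
      · cases hfb : f b <;> simp [d, hpb, h, hfb]
      · cases hfb : f b <;> simp [d, hpb, h, hfb]
      · simp [d, hpb, h, h3 (h' hpb)]
    · have hqb : G.Adj q b := by tauto
      rcases h1 with h | h | ⟨h, -⟩ <;> cases hgb : g b <;> simp [d, hpb, hqb, h, hgb]
  refine ⟨Coloring.mk d fun {a b} hab => ?_⟩
  by_cases ha : a ∈ farSet G p q <;> by_cases hb : b ∈ farSet G p q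
  · have h2 : d a = c (K a) a := by simp [d, ha.1, ha.2]
    have h3 : d b = c (K b) b := by simp [d, hb.1, hb.2]
    have hbK := (hK a ha).1.closed a (hK a ha).2 b hb hab
    rw [h2, h3, (hK b hb).1.eq_of_mem (hK a ha).1 (hK b hb).2 hbK]
    exact hc _ (hK a ha).1 a (hK a ha).2 b hbK hab
  · exact hmixed a b ha hb hab
  · exact (hmixed b a hb ha hab.symm).symm
  · simp only [farSet, Set.mem_ofPred_eq] at ha hb
    have h1 := hf a b
    have h2 := hg a b
    by_cases hpa : G.Adj p a <;> by_cases hpb : G.Adj p b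
    · have := h1 hpa hpb hab
      cases hfa : f a <;> cases hfb : f b <;> simp_all [d]
    · have hqb : G.Adj q b := by tauto
      cases hfa : f a <;> cases hgb : g b <;> simp [d, hpa, hpb, hqb, hfa, hgb]
    · have hqa : G.Adj q a := by tauto
      cases hga : g a <;> cases hfb : f b <;> simp [d, hpa, hpb, hqa, hga, hfb]
    · have hqa : G.Adj q a := by tauto
      have hqb : G.Adj q b := by tauto
      have := h2 hqa hqb hab
      cases hga : g a <;> cases hgb : g b <;> simp_all [d]

theorem exists_six_coloring_on {p q : V} {K S : Set V} (hK : IsComp G (farSet G p q) K)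
    (hpq : G.Adj p q) (hind : ∃ c : V → Fin 6, ∀ a b, a ≠ p → b ≠ p → G.Adj a b → c a ≠ c b)
    (h : BipartiteOn G K ∨ (∀ a ∈ K, ∀ u, u ∉ farSet G p q → ¬ G.Adj a u) ∨
      ∃ c : V → Fin 3, (∀ a ∈ K, ∀ b ∈ K, G.Adj a b → c a ≠ c b) ∧
        ∀ a ∈ K, c a = 0 → ∀ u, G.Adj p u → G.Adj a u → u ∈ S) :
    ∃ c : V → Fin 6, (∀ a ∈ K, ∀ b ∈ K, G.Adj a b → c a ≠ c b) ∧
      ∀ a ∈ K, ∀ u, u ∉ farSet G p q → G.Adj a u →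
        c a = 4 ∨ c a = 5 ∨ (c a = 1 ∧ (G.Adj p u → u ∈ S)) := by
  classical
  rcases h with ⟨P, hPK⟩ | h | ⟨c, hc, hcS⟩
  · refine ⟨fun a => if a ∈ P then 4 else 5, fun a ha b hb hab => ?_, fun a ha u hu hau => ?_⟩
    · have := hPK a ha b hb hab
      by_cases h1 : a ∈ P <;> by_cases h2 : b ∈ P <;> simp_all
    · by_cases h1 : a ∈ P <;> simp [h1]
  · obtain ⟨c, hc⟩ := hind
    have hne : ∀ a ∈ K, a ≠ p := fun a ha hap => (hK.subset ha).2 (hap ▸ hpq.symm)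
    exact ⟨c, fun a ha b hb hab => hc a b (hne a ha) (hne b hb) hab,
      fun a ha u hu hau => absurd hau (h a ha u hu)⟩
  · have hinj : Function.Injective (![1, 4, 5] : Fin 3 → Fin 6) := by decide
    refine ⟨fun a => ![1, 4, 5] (c a), fun a ha b hb hab h => hc a ha b hb hab (hinj h),
      fun a ha u hu hau => ?_⟩
    have h0 := hcS a ha
    beta_reduce
    generalize c a = i at h0 ⊢
    fin_cases i
    · exact Or.inr (Or.inr ⟨rfl, fun hpu => h0 rfl u hpu hau⟩)
    · exact Or.inl rfl
    · exact Or.inr (Or.inl rfl)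

theorem IsTriangle.adj {K : Set V} (hK : IsTriangle G K) {a b : V} (ha : a ∈ K) (hb : b ∈ K)
    (hab : a ≠ b) : G.Adj a b := by
  obtain ⟨x, y, z, hxy, hyz, hxz, h⟩ := hK
  have := hxy.symm; have := hyz.symm; have := hxz.symm
  rcases (h a).1 ha with rfl | rfl | rfl <;> rcases (h b).1 hb with rfl | rfl | rfl <;>
    first | assumption | exact absurd rfl hab

theorem IsTriangle.exists_third {K : Set V} (hK : IsTriangle G K) {a b : V} (ha : a ∈ K)
    (hb : b ∈ K) (hab : a ≠ b) :
    ∃ c ∈ K, c ≠ a ∧ c ≠ b ∧ ∀ u ∈ K, u = a ∨ u = b ∨ u = c := by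
  obtain ⟨x, y, z, hxy, hyz, hxz, h⟩ := hK
  have := hxy.ne; have := hyz.ne; have := hxz.ne
  obtain ⟨c, hc, hca, hcb⟩ : ∃ c, (c = x ∨ c = y ∨ c = z) ∧ c ≠ a ∧ c ≠ b := by
    by_cases h1 : x ≠ a ∧ x ≠ b
    · exact ⟨x, by simp, h1⟩
    by_cases h2 : y ≠ a ∧ y ≠ b
    · exact ⟨y, by simp, h2⟩
    exact ⟨z, by simp, by grind, by grind⟩
  refine ⟨c, (h c).2 hc, hca, hcb, fun u hu => ?_⟩
  have h1 := (h a).1 ha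
  have h2 := (h b).1 hb
  have h3 := (h u).1 hu
  clear h
  grind

theorem IsTriangle.exists_ne {K : Set V} (hK : IsTriangle G K) (a : V) : ∃ b ∈ K, b ≠ a := by
  obtain ⟨x, y, z, hxy, hyz, hxz, h⟩ := hK
  by_cases hxa : x = a
  · exact ⟨y, (h y).2 (by simp), hxa ▸ hxy.ne'⟩
  · exact ⟨x, (h x).2 (by simp), hxa⟩

theorem IsTriangle.exists_coloring {K : Set V} (hK : IsTriangle G K) {y : V} (hy : y ∈ K) :
    ∃ c : V → Fin 3, (∀ a ∈ K, ∀ b ∈ K, G.Adj a b → c a ≠ c b) ∧ ∀ a, c a = 0 → a = y := by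
  classical
  obtain ⟨x, hx, hxy⟩ := hK.exists_ne y
  obtain ⟨z, hz, hzy, hzx, h⟩ := hK.exists_third hy hx hxy.symm
  refine ⟨fun a => if a = y then 0 else if a = x then 1 else 2, fun a ha b hb hab => ?_,
    fun a ha => ?_⟩
  · have := hab.ne
    rcases h a ha with rfl | rfl | rfl <;> rcases h b hb with rfl | rfl | rfl <;> simp_all
  · by_contra hay
    by_cases hax : a = x <;> simp_all

theorem colorable_of_no_triangle_at [Finite V] (hU : UniqueTriangles G) (hP : NoInducedSixPath G)
    (hN : FourNeighbors G) {p : V}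
    (hind : ∃ c : V → Fin 6, ∀ a b, a ≠ p → b ≠ p → G.Adj a b → c a ≠ c b)
    (hp : ∀ a b, G.Adj p a → G.Adj p b → ¬ G.Adj a b) : G.Colorable 6 := by
  obtain ⟨q, hpq, -⟩ := hN p p p p
  refine colorable_of_components (p := p) (q := q) hU {u | G.Adj p u}
    (fun s hs t ht => hp s t hs ht) fun K hK => exists_six_coloring_on hK hpq hind ?_
  refine Or.inr ?_
  by_cases ht : ∃ a ∈ K, ∃ u, u ∉ farSet G p q ∧ G.Adj a u
  · right
    obtain ⟨a, ha, u, hu, hau⟩ := ht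
    rcases isTriangle_or_splitByPrivate hU hP hN hpq hK with hT | hS
    · obtain ⟨c, hc, -⟩ := hT.exists_coloring ha
      exact ⟨c, hc, fun _ _ _ _ h _ => h⟩
    · have haD := hK.subset ha
      have hup : u ≠ p := fun h => haD.1 (h ▸ hau.symm)
      have huq : u ≠ q := fun h => haD.2 (h ▸ hau.symm)
      have h1 : G.Adj p u → ¬ G.Adj q u := fun h h' => hp q u hpq h h'
      have hu' : IsPrivate G p q u := by
        simp only [farSet, Set.mem_ofPred_eq] at hu
        unfold IsPrivate
        tauto
      obtain ⟨c, hc, -⟩ := (hS u hu' ⟨a, ha, hau.symm⟩).exists_coloring hU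
      exact ⟨c, hc, fun _ _ _ _ h _ => h⟩
  · left
    push Not at ht
    exact ht

/-- The vertices of `K` eligible for the colour shared with the neighbourhood of `p`, where `r`
completes the edge `pq` to a triangle. -/
def IsFree (G : SimpleGraph V) (p q r : V) (K : Set V) (k : V) : Prop :=
  k ∈ K ∧ (SplitByPrivate G p q K ∨ (IsTriangle G K ∧ ¬ G.Adj r k))

theorem bipartiteOn_of_forall_adj [Finite V] (hU : UniqueTriangles G) {w : V} {K : Set V}
    (h : ∀ k ∈ K, G.Adj w k) : BipartiteOn G K := by
  obtain ⟨f, hf, -⟩ := exists_two_coloring hU w ∅ (by simp)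
  refine ⟨{a | f a = true}, fun a ha b hb hab => ?_⟩
  have := hf a b (h a ha) (h b hb) hab
  cases hfa : f a <;> cases hfb : f b <;> simp_all

theorem exists_private_edge [Finite V] (hU : UniqueTriangles G) (hP : NoInducedSixPath G)
    (hN : FourNeighbors G) {p q r : V} (hpq : G.Adj p q) (hpr : G.Adj p r) (hqr : G.Adj q r)
    {K : Set V} (hK : IsComp G (farSet G p q) K) (hb : ¬ BipartiteOn G K) {w w' k : V}
    (hpw : G.Adj p w) (hwq : w ≠ q) (hwr : w ≠ r) (hpw' : G.Adj p w') (hwq' : w' ≠ q)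
    (hwr' : w' ≠ r) (hww : G.Adj w w') (hk : IsFree G p q r K k) (hwk : G.Adj w k) :
    (∀ l, IsFree G p q r K l → ¬ G.Adj w' l) ∧ ∃ a ∈ K, ∃ b ∈ K, G.Adj a b ∧ G.Adj w a ∧
      ¬ G.Adj w b ∧ ¬ G.Adj w' a ∧ ¬ G.Adj w' b := by
  have hw : IsPrivate G p q w :=
    Or.inl ⟨hpw, hwq, fun h => hwr (hU p q w r hpq hpw h hpr hqr)⟩
  have hw' : IsPrivate G p q w' :=
    Or.inl ⟨hpw', hwq', fun h => hwr' (hU p q w' r hpq hpw' h hpr hqr)⟩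
  have hdisj : ∀ a ∈ K, G.Adj w a → ¬ G.Adj w' a := fun a ha h h' =>
    (hK.subset ha).2 (hU w w' a p hww h h' hpw.symm hpw'.symm ▸ hpq.symm)
  by_cases hS : SplitByPrivate G p q K
  · have hsw := hS w hw ⟨k, hk.1, hwk⟩
    have hno : ∀ l ∈ K, ¬ G.Adj w' l := by
      intro l hl hl'
      have hsw' := hS w' hw' ⟨l, hl, hl'⟩
      refine hb ⟨{a | G.Adj w a}, fun a ha b hb hab => ⟨fun h h' => ?_, fun h => ?_⟩⟩
      · exact hsw' a ha b hb (hdisj a ha h) (hdisj b hb h') hab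
      · by_contra h'
        exact hsw a ha b hb h' h hab
    refine ⟨fun l hl => hno l hl.1, ?_⟩
    obtain ⟨y, hy, hwy⟩ : ∃ y ∈ K, ¬ G.Adj w y := by
      by_contra! h
      exact hb (bipartiteOn_of_forall_adj hU h)
    obtain ⟨x, hx, hwx, hxy⟩ :=
      (hw.dominating hP hpq hK).exists_adj hK ⟨k, hk.1, hwk⟩ hy hwy
    exact ⟨x, hx, y, hy, hxy, hwx, hwy, hno x hx, hno y hy⟩
  · have hfree : ∀ l, IsFree G p q r K l → l ∈ K ∧ IsTriangle G K ∧ ¬ G.Adj r l :=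
      fun l hl => ⟨hl.1, hl.2.resolve_left hS⟩
    obtain ⟨hkK, hT, hrk⟩ := hfree k hk
    have honly : ∀ v, v ∉ K → ∀ a ∈ K, ∀ b ∈ K, a ≠ b → G.Adj v a → ¬ G.Adj v b := by
      intro v hv a ha b hb hab hva hvb
      obtain ⟨c, hc, hca, hcb, -⟩ := hT.exists_third ha hb hab
      exact hv (hU a b v c (hT.adj ha hb hab) hva.symm hvb.symm (hT.adj ha hc hca.symm)
        (hT.adj hb hc hcb.symm) ▸ hc)
    have hwK : w ∉ K := fun h => (hK.subset h).1 hpw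
    have hwK' : w' ∉ K := fun h => (hK.subset h).1 hpw'
    have hrK : r ∉ K := fun h => (hK.subset h).1 hpr
    have hno : ∀ l, IsFree G p q r K l → ¬ G.Adj w' l := by
      intro l hl hwl
      obtain ⟨hlK, -, hrl⟩ := hfree l hl
      have hkl : k ≠ l := fun h => hdisj k hkK hwk (h ▸ hwl)
      obtain ⟨m, hm, -, -, hKm⟩ := hT.exists_third hkK hlK hkl
      obtain ⟨c, hrc, hcp, hcq, hcm⟩ := hN r p q m
      have hpc : ¬ G.Adj p c := fun h => hcq (hU p r c q hpr h hrc hpq hqr.symm)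
      have hqc : ¬ G.Adj q c := fun h => hcp (hU q r c p hqr h hrc hpq.symm hpr.symm)
      have hcK : c ∉ K := by
        intro h
        rcases hKm c h with rfl | rfl | rfl
        exacts [hrk hrc, hrl hrc, hcm rfl]
      have hcl : ∀ a ∈ K, ¬ G.Adj c a := fun a ha h => hcK (hK.closed a ha c ⟨hpc, hqc⟩ h.symm)
      have hrw : ∀ v, G.Adj p v → v ≠ q → ¬ G.Adj r v := fun v hv hvq h =>
        hvq (hU p r v q hpr hv h hpq hqr.symm)
      have hpath : ∀ v a b, G.Adj p v → v ≠ q → v ∉ K → G.Adj v a → a ∈ K → b ∈ K → a ≠ b →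
          ¬ G.Adj r a → ¬ G.Adj r b → G.Adj c v := by
        intro v a b hpv hvq hvK hva ha hb hab hra hrb
        by_contra hcv
        exact hP c r p v a b hrc.symm hpr.symm hpv hva (hT.adj ha hb hab) (fun h => hpc h.symm)
          hcv (hcl a ha) (hcl b hb) (hrw v hpv hvq) hra hrb (hK.subset ha).1 (hK.subset hb).1
          (honly v hvK a ha b hb hab hva)
      have h1 := hpath w k l hpw hwq hwK hwk hkK hlK hkl hrk hrl
      have h2 := hpath w' l k hpw' hwq' hwK' hwl hlK hkK hkl.symm hrl hrk
      exact hcp (hU w w' c p hww h1.symm h2.symm hpw.symm hpw'.symm)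
    refine ⟨hno, ?_⟩
    obtain ⟨b, hb, hbk, hrb⟩ : ∃ b ∈ K, b ≠ k ∧ ¬ G.Adj r b := by
      obtain ⟨b, hb, hbk⟩ := hT.exists_ne k
      obtain ⟨m, hm, hmk, hmb, -⟩ := hT.exists_third hkK hb hbk.symm
      by_cases h : G.Adj r b
      · exact ⟨m, hm, hmk, honly r hrK b hb m hm hmb.symm h⟩
      · exact ⟨b, hb, hbk, h⟩
    exact ⟨k, hkK, b, hb, hT.adj hkK hb hbk.symm, hwk, honly w hwK k hkK b hb hbk.symm hwk,
      hdisj k hkK hwk, hno b ⟨hb, Or.inr ⟨hT, hrb⟩⟩⟩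

/-- The neighbours of `p` outside the triangle `pqr` that see a free vertex of some component. -/
def activeSet (G : SimpleGraph V) (p q r : V) : Set V :=
  {w | G.Adj p w ∧ w ≠ q ∧ w ≠ r ∧ ∃ K, IsComp G (farSet G p q) K ∧ ¬ BipartiteOn G K ∧
    ∃ k, IsFree G p q r K k ∧ G.Adj w k}

theorem activeSet_independent [Finite V] (hU : UniqueTriangles G) (hP : NoInducedSixPath G)
    (hN : FourNeighbors G) {p q r : V} (hpq : G.Adj p q) (hpr : G.Adj p r) (hqr : G.Adj q r)
    {w w' : V} (hw : w ∈ activeSet G p q r) (hw' : w' ∈ activeSet G p q r) : ¬ G.Adj w w' := by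
  intro hww
  obtain ⟨hpw, hwq, hwr, K, hK, hb, k, hk, hwk⟩ := hw
  obtain ⟨hpw', hwq', hwr', L, hL, hbL, l, hl, hwl⟩ := hw'
  obtain ⟨hno, a, ha, b, hb, hab, hwa, hwb, hwa', hwb'⟩ :=
    exists_private_edge hU hP hN hpq hpr hqr hK hb hpw hwq hwr hpw' hwq' hwr' hww hk hwk
  obtain ⟨-, c, hc, d, hd, hcd, hwc, hwd, hwc', hwd'⟩ :=
    exists_private_edge hU hP hN hpq hpr hqr hL hbL hpw' hwq' hwr' hpw hwq hwr hww.symm hl hwl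
  have hKL : ∀ x ∈ K, ∀ y ∈ L, ¬ G.Adj x y := by
    intro x hx y hy hxy
    have hyK := hK.closed x hx y (hL.subset hy) hxy
    have := hK.eq_of_mem hL hyK hy
    subst this
    exact hno l hl hwl
  exact hP b a w w' c d hab.symm hwa.symm hww hwc hcd (fun h => hwb h.symm)
    (fun h => hwb' h.symm) (hKL b hb c hc) (hKL b hb d hd) (fun h => hwa' h.symm)
    (hKL a ha c hc) (hKL a ha d hd) hwc' hwd' hwd

theorem colorable_of_triangle [Finite V] (hU : UniqueTriangles G) (hP : NoInducedSixPath G)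
    (hN : FourNeighbors G) {p q r : V} (hpq : G.Adj p q) (hpr : G.Adj p r) (hqr : G.Adj q r)
    (hind : ∃ c : V → Fin 6, ∀ a b, a ≠ p → b ≠ p → G.Adj a b → c a ≠ c b) :
    G.Colorable 6 := by
  have hr : ∀ w ∈ activeSet G p q r, ¬ G.Adj r w := fun w hw h =>
    hw.2.1 (hU p r w q hpr hw.1 h hpq hqr.symm)
  refine colorable_of_components (p := p) (q := q) hU (insert r (activeSet G p q r)) ?_
    fun K hK => exists_six_coloring_on hK hpq hind ?_
  · rintro s (rfl | hs) t (rfl | ht)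
    · exact fun h => h.ne rfl
    · exact hr t ht
    · exact fun h => hr s hs h.symm
    · exact activeSet_independent hU hP hN hpq hpr hqr hs ht
  by_cases hb : BipartiteOn G K
  · exact Or.inl hb
  refine Or.inr ?_
  have hprivate : ∀ a ∈ K, ∀ u, u ∉ farSet G p q → G.Adj a u → u ≠ r → IsPrivate G p q u := by
    intro a ha u hu hau hur
    have haD := hK.subset ha
    have hup : u ≠ p := fun h => haD.1 (h ▸ hau.symm)
    have huq : u ≠ q := fun h => haD.2 (h ▸ hau.symm)
    have h1 : G.Adj p u → ¬ G.Adj q u := fun h h' => hur (hU p q u r hpq h h' hpr hqr)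
    simp only [farSet, Set.mem_ofPred_eq] at hu
    unfold IsPrivate
    tauto
  have hactive : ∀ a, IsFree G p q r K a → ∀ u, G.Adj p u → G.Adj a u →
      u ∈ insert r (activeSet G p q r) := by
    intro a ha u hpu hau
    by_cases hur : u = r
    · exact Or.inl hur
    · have huq : u ≠ q := fun h => (hK.subset ha.1).2 (h ▸ hau.symm)
      exact Or.inr ⟨hpu, huq, hur, K, hK, hb, a, ha, hau.symm⟩
  by_cases ht : ∃ a ∈ K, ∃ u, u ≠ r ∧ u ∉ farSet G p q ∧ G.Adj a u
  · right
    obtain ⟨a, ha, u, hur, hu, hau⟩ := ht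
    rcases isTriangle_or_splitByPrivate hU hP hN hpq hK with hT | hS
    · obtain ⟨y, hy, hry⟩ : ∃ y ∈ K, ¬ G.Adj r y := by
        obtain ⟨b, hb, hba⟩ := hT.exists_ne a
        obtain ⟨m, hm, hma, hmb, -⟩ := hT.exists_third ha hb hba.symm
        by_contra! h
        exact (hK.subset hm).1 (hU a b r m (hT.adj ha hb hba.symm) (h a ha).symm (h b hb).symm
          (hT.adj ha hm hma.symm) (hT.adj hb hm hmb.symm) ▸ hpr)
      obtain ⟨c, hc, hcy⟩ := hT.exists_coloring hy
      refine ⟨c, hc, fun a ha h0 => hactive a ⟨ha, Or.inr ⟨hT, ?_⟩⟩⟩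
      exact hcy a h0 ▸ hry
    · obtain ⟨c, hc, -⟩ := (hS u (hprivate a ha u hu hau hur) ⟨a, ha, hau.symm⟩).exists_coloring hU
      exact ⟨c, hc, fun a ha _ => hactive a ⟨ha, Or.inl hS⟩⟩
  · push Not at ht
    have hout : ∀ a ∈ K, ∀ u, G.Adj a u → u = r ∨ u ∈ K := by
      intro a ha u hau
      by_cases hur : u = r
      · exact Or.inl hur
      by_cases hu : u ∈ farSet G p q
      · exact Or.inr (hK.closed a ha u hu hau)
      · exact absurd hau (ht a ha u hur hu)
    by_cases htr : ∃ k ∈ K, G.Adj r k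
    · right
      obtain ⟨s, hps, hsq, hsr, -⟩ := hN p q r r
      have hsK : ∀ k ∈ K, ¬ G.Adj s k := fun k hk h =>
        ht k hk s hsr (fun hs => hs.1 hps) h.symm
      have hsr' : ¬ G.Adj s r := fun h => hsq (hU p r s q hpr hps h.symm hpq hqr.symm)
      have hdom : Dominating G r K := dominating_of_tail hP hps.symm hpr hsr' hsK
        fun k hk => (hK.subset hk).1
      have hsplit : SplitBy G r K := by
        intro y hy z hz hry hrz hyz
        obtain ⟨x, hx, -, -, -, hny, -⟩ := hdom.exists_triangle hU hK htr hy hz hry hrz hyz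
        obtain ⟨u, hyu, hux, huz, hur⟩ := hN y x z r
        rcases hny u ((hout y hy u hyu).resolve_left hur) hyu with h | h
        exacts [hux h, huz h]
      obtain ⟨c, hc, hc0⟩ := hsplit.exists_coloring hU
      refine ⟨c, hc, fun a ha h0 u hpu hau => ?_⟩
      rcases hout a ha u hau with rfl | hu
      · exact Or.inl rfl
      · exact absurd hpu (hK.subset hu).1
    · left
      intro a ha u hu hau
      rcases hout a ha u hau with rfl | h
      · exact htr ⟨a, ha, hau.symm⟩
      · exact hu (hK.subset h)

theorem colorable_six [Finite V] (hU : UniqueTriangles G) (hP : NoInducedSixPath G)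
    (hind : ∀ v : V, ∃ c : V → Fin 6, ∀ a b, a ≠ v → b ≠ v → G.Adj a b → c a ≠ c b) :
    G.Colorable 6 := by
  classical
  by_cases hN : FourNeighbors G
  · by_cases hT : ∃ p q r, G.Adj p q ∧ G.Adj p r ∧ G.Adj q r
    · obtain ⟨p, q, r, hpq, hpr, hqr⟩ := hT
      exact colorable_of_triangle hU hP hN hpq hpr hqr (hind p)
    · push Not at hT
      rcases isEmpty_or_nonempty V with h | ⟨⟨p⟩⟩
      · exact ⟨Coloring.mk isEmptyElim fun {a} => isEmptyElim a⟩
      · exact colorable_of_no_triangle_at hU hP hN (hind p) fun a b => hT p a b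
  · unfold FourNeighbors at hN
    push Not at hN
    obtain ⟨v, x, y, z, hv⟩ := hN
    obtain ⟨c, hc⟩ := hind v
    obtain ⟨i, hi⟩ : ∃ i : Fin 6, i ≠ c x ∧ i ≠ c y ∧ i ≠ c z := by
      have : ∀ a b d : Fin 6, ∃ i : Fin 6, i ≠ a ∧ i ≠ b ∧ i ≠ d := by decide
      exact this _ _ _
    have hiv : ∀ u, G.Adj v u → i ≠ c u := by
      intro u hu
      by_cases hux : u = x
      · exact hux ▸ hi.1
      by_cases huy : u = y
      · exact huy ▸ hi.2.1
      exact hv u hu hux huy ▸ hi.2.2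
    refine ⟨Coloring.mk (fun u => if u = v then i else c u) fun {a b} hab => ?_⟩
    by_cases ha : a = v
    · subst ha
      simpa [hab.ne'] using hiv b hab
    · by_cases hb : b = v
      · subst hb
        simpa [hab.ne] using (hiv a hab.symm).symm
      · simpa [ha, hb] using hc a b ha hb hab

theorem IndFree.induce {α : Type*} {H : SimpleGraph α} (h : IndFree H G) (s : Set V) :
    IndFree H (G.induce s) :=
  fun ⟨e⟩ => h ⟨(Embedding.induce s).comp e⟩

theorem colorable_six_of_card_le (n : ℕ) : ∀ {V : Type*} [Fintype V] (G : SimpleGraph V),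
    Fintype.card V ≤ n → IndFree (pathGraph 6) G → IndFree diamond G → IndFree K4 G →
      G.Colorable 6 := by
  classical
  induction n with
  | zero =>
    intro V _ G hn _ _ _
    have := Fintype.card_eq_zero_iff.1 (Nat.le_zero.1 hn)
    exact ⟨Coloring.mk isEmptyElim fun {a} => isEmptyElim a⟩
  | succ n ih =>
    intro V _ G hn hP hD hK
    refine colorable_six (uniqueTriangles_of_indFree hD hK) (noInducedSixPath_of_indFree hP)
      fun v => ?_
    have hcard : Fintype.card {u : V // u ≠ v} < Fintype.card V :=
      Fintype.card_subtype_lt (x := v) (by simp)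
    obtain ⟨c⟩ := ih (G.induce {u | u ≠ v}) (by
      have : Fintype.card ({u | u ≠ v} : Set V) = Fintype.card {u : V // u ≠ v} :=
        Fintype.card_congr (Equiv.refl _)
      omega) (hP.induce _) (hD.induce _) (hK.induce _)
    refine ⟨fun u => if h : u ≠ v then c ⟨u, h⟩ else 0, fun a b ha hb hab => ?_⟩
    simp only [ha, hb, ne_eq, not_false_eq_true, dite_true]
    exact c.valid (v := ⟨a, ha⟩) (w := ⟨b, hb⟩) hab

end

/-- Every (P6, diamond, K4)-free graph is 6-colorable. -/
theorem stmt5 {V : Type*} [Fintype V] (G : SimpleGraph V)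
    (hP : IndFree (pathGraph 6) G) (hD : IndFree diamond G) (hK : IndFree K4 G) :
    G.Colorable 6 :=
  colorable_six_of_card_le _ G le_rfl hP hD hK
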